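/- arXiv:1504.01612 — 2 statements merged into one kernel-verified Lean document; each statement's English description precedes it below -/
import Mathlib

section
/- Fix α ∈ (0,1) and γ ∈ (0,1). For n ≥ 1 define f(p; α) = ( Γ(n+2) / ( Γ(αn+1)·Γ((1−α)n+1) ) )·p^{αn}·(1−p)^{(1−α)n} on (0,1), and the weighted Fisher information I_n^{φ}(α) = ∫₀¹ φ_n(p)·( ∂/∂α log f(p;α) )² · f(p;α) dp, where φ_n(p) = Λ_n(γ)·p^{γ√n}·(1−p)^{(1−γ)√n} is normalized so that ∫₀¹ φ_n(p)·f(p;α) dp = 1. Set A(α,γ) = 1/( α(1−α) ) + (α−γ)²/( α²(1−α)² ) and B(α,γ) = ( 2αγ − γ − α² )/( (1−α)²α² ) + ( (α−γ)²·( α(2γ−1) − γ ) )/( (1−α)³α³ ). Then there exists a constant C(α,γ), depending only on α and γ, such that lim_{n→∞} [ I_n^{φ}(α) − A(α,γ)·n − B(α,γ)·√n ] = C(α,γ). -/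
open MeasureTheory Real Filter

/-- The digamma function `ψ(x) = (d/dx) log Γ(x)`. -/
noncomputable def digamma (x : ℝ) : ℝ :=
  deriv (fun y => Real.log (Real.Gamma y)) x

/-- The real-parameter Beta(αn+1, (1-α)n+1) density `f(p;α)` on `(0,1)`. -/
noncomputable def betaDensR (n : ℕ) (a p : ℝ) : ℝ :=
  Real.Gamma ((n : ℝ) + 2) / (Real.Gamma (a * n + 1) * Real.Gamma ((1 - a) * n + 1)) *
    p ^ (a * (n : ℝ)) * (1 - p) ^ ((1 - a) * (n : ℝ))

/-- Normalizing constant `Λ_n(γ)` of the weight function for the real-parameter family: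
`Λ_n(γ) = Γ(αn+1)Γ((1-α)n+1)Γ(n+2+√n) / (Γ(αn+γ√n+1)Γ((1-α)n+1+(1-γ)√n)Γ(n+2))`. -/
noncomputable def weightLambdaR (n : ℕ) (α γ : ℝ) : ℝ :=
  Real.Gamma (α * n + 1) * Real.Gamma ((1 - α) * n + 1) *
    Real.Gamma ((n : ℝ) + 2 + Real.sqrt n) /
  (Real.Gamma (α * n + γ * Real.sqrt n + 1) *
    Real.Gamma ((1 - α) * n + 1 + (1 - γ) * Real.sqrt n) *
    Real.Gamma ((n : ℝ) + 2))

/-- The weight function `φ_n(p) = Λ_n(γ) p^{γ√n} (1-p)^{(1-γ)√n}`, normalized so that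
`∫₀¹ φ_n f(·;α) = 1`. -/
noncomputable def weightPhiR (n : ℕ) (α γ : ℝ) (p : ℝ) : ℝ :=
  weightLambdaR n α γ * p ^ (γ * Real.sqrt n) * (1 - p) ^ ((1 - γ) * Real.sqrt n)

/-- Weighted Fisher information `I_n^φ(α) = ∫₀¹ φ_n(p) (∂_α log f(p;α))² f(p;α) dp`. -/
noncomputable def weightedFisherInfo (n : ℕ) (α γ : ℝ) : ℝ :=
  ∫ p in Set.Ioo (0 : ℝ) 1,
    weightPhiR n α γ p * (deriv (fun a => Real.log (betaDensR n a p)) α) ^ 2 *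
      betaDensR n α p

open ProbabilityTheory Set Topology

/-- `log Γ` on the reals. -/
noncomputable def logGamma (x : ℝ) : ℝ := Real.log (Real.Gamma x)

theorem analyticAt_logGamma {x : ℝ} (hx : 0 < x) : AnalyticAt ℝ logGamma x := by
  have hopen : IsOpen {z : ℂ | 0 < z.re} := isOpen_lt continuous_const Complex.continuous_re
  have hd : DifferentiableOn ℂ Complex.Gamma {z : ℂ | 0 < z.re} := fun z hz =>
    (Complex.differentiableAt_Gamma z fun m hm => by
      simp only [mem_ofPred_eq, hm, Complex.neg_re, Complex.natCast_re] at hz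
      have : (0 : ℝ) ≤ m := m.cast_nonneg
      linarith).differentiableWithinAt
  have hc : ContDiffAt ℂ ⊤ Complex.Gamma (x : ℂ) :=
    (hd.contDiffOn hopen).contDiffAt (hopen.mem_nhds (by simpa using hx))
  have hr : ContDiffAt ℝ ⊤ Real.Gamma x := hc.real_of_complex
  exact (hr.log (Real.Gamma_pos_of_pos hx).ne').analyticAt

theorem hasDerivAt_logGamma {x : ℝ} (hx : 0 < x) : HasDerivAt logGamma (digamma x) x :=
  (analyticAt_logGamma hx).differentiableAt.hasDerivAt

theorem hasDerivAt_digamma {x : ℝ} (hx : 0 < x) : HasDerivAt digamma (deriv digamma x) x :=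
  (analyticAt_logGamma hx).deriv.differentiableAt.hasDerivAt

theorem logGamma_add_one {x : ℝ} (hx : 0 < x) :
    logGamma (x + 1) = Real.log x + logGamma x := by
  rw [logGamma, Real.Gamma_add_one hx.ne', Real.log_mul hx.ne' (Real.Gamma_pos_of_pos hx).ne',
    logGamma]

theorem digamma_add_one {x : ℝ} (hx : 0 < x) : digamma (x + 1) = digamma x + 1 / x := by
  have h1 : HasDerivAt (fun y => logGamma (y + 1)) (digamma (x + 1)) x :=
    (hasDerivAt_logGamma (by linarith : 0 < x + 1)).comp_add_const x 1
  have h2 : HasDerivAt (fun y => Real.log y + logGamma y) (x⁻¹ + digamma x) x :=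
    (Real.hasDerivAt_log hx.ne').add (hasDerivAt_logGamma hx)
  have h3 := h2.congr_of_eventuallyEq
    ((eventually_gt_nhds hx).mono fun y hy => logGamma_add_one hy)
  rw [h1.unique h3, one_div, add_comm]

theorem deriv_digamma_add_one {x : ℝ} (hx : 0 < x) :
    deriv digamma (x + 1) = deriv digamma x - 1 / x ^ 2 := by
  have h1 : HasDerivAt (fun y => digamma (y + 1)) (deriv digamma (x + 1)) x :=
    (hasDerivAt_digamma (by linarith : 0 < x + 1)).comp_add_const x 1
  have h2 : HasDerivAt (fun y => digamma y + y⁻¹) (deriv digamma x + -(x ^ 2)⁻¹) x :=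
    (hasDerivAt_digamma hx).add (hasDerivAt_inv hx.ne')
  have h3 := h2.congr_of_eventuallyEq (f₁ := fun y => digamma (y + 1))
    ((eventually_gt_nhds hx).mono fun y hy => by simp only; rw [digamma_add_one hy, one_div])
  rw [h1.unique h3, one_div, sub_eq_add_neg]

theorem digamma_le_log {x : ℝ} (hx : 0 < x) : digamma x ≤ Real.log x := by
  have hconv : ConvexOn ℝ (Ioi 0) logGamma := Real.convexOn_log_Gamma
  have h := hconv.le_slope_of_hasDerivAt (mem_Ioi.2 hx) (mem_Ioi.2 (by linarith : 0 < x + 1))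
    (by linarith) (hasDerivAt_logGamma hx)
  rwa [slope_def_field, logGamma_add_one hx, add_sub_cancel_right, add_sub_cancel_left,
    div_one] at h

/-- A function on the positive reals that decreases along unit steps to the limit zero is
nonnegative. -/
theorem nonneg_of_antitone_step {F : ℝ → ℝ} (hF : ∀ x, 0 < x → F (x + 1) ≤ F x)
    (hlim : Tendsto F atTop (𝓝 0)) {x : ℝ} (hx : 0 < x) :
    0 ≤ F x := by
  have hanti : Antitone fun n : ℕ => F (x + n) := antitone_nat_of_succ_le fun n => by
    simpa [add_assoc] using hF (x + n) (by positivity)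
  simpa using hanti.le_of_tendsto
    (hlim.comp (tendsto_atTop_add_const_left _ x tendsto_natCast_atTop_atTop)) 0

theorem betaPDFReal_nonneg {a b : ℝ} (ha : 0 < a) (hb : 0 < b) (p : ℝ) :
    0 ≤ betaPDFReal a b p := by
  by_cases hp : 0 < p ∧ p < 1
  · exact (betaPDFReal_pos hp.1 hp.2 ha hb).le
  · simp [betaPDFReal, hp]

theorem integral_betaMeasure {a b : ℝ} (ha : 0 < a) (hb : 0 < b) (f : ℝ → ℝ) :
    ∫ p, f p ∂betaMeasure a b = ∫ p in Ioo 0 1, betaPDFReal a b p * f p := by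
  rw [betaMeasure, integral_withDensity_eq_integral_toReal_smul (by unfold betaPDF; fun_prop)
    (by simp [betaPDF]), setIntegral_eq_integral_of_forall_compl_eq_zero]
  · simp [betaPDF, ENNReal.toReal_ofReal, betaPDFReal_nonneg ha hb]
  · intro p hp
    simp only [mem_Ioo] at hp
    simp [betaPDFReal, hp]

theorem integrable_betaMeasure_iff {a b : ℝ} (ha : 0 < a) (hb : 0 < b) {f : ℝ → ℝ} :
    Integrable f (betaMeasure a b) ↔
      IntegrableOn (fun p => betaPDFReal a b p * f p) (Ioo 0 1) := by
  rw [betaMeasure, integrable_withDensity_iff_integrable_smul' (by unfold betaPDF; fun_prop)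
    (by simp [betaPDF]), integrableOn_iff_integrable_of_support_subset]
  · simp [betaPDF, ENNReal.toReal_ofReal, betaPDFReal_nonneg ha hb]
  · intro p hp
    by_contra h
    simp only [mem_Ioo] at h
    simp [betaPDFReal, h] at hp

theorem integrable_one_beta {a b : ℝ} (ha : 0 < a) (hb : 0 < b) :
    IntegrableOn (betaPDFReal a b) (Ioo 0 1) := by
  have := isProbabilityMeasureBeta ha hb
  simpa using (integrable_betaMeasure_iff ha hb).1 (integrable_const (1 : ℝ))

theorem integral_one_beta {a b : ℝ} (ha : 0 < a) (hb : 0 < b) :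
    ∫ p in Ioo 0 1, betaPDFReal a b p = 1 := by
  have := isProbabilityMeasureBeta ha hb
  simpa using (integral_betaMeasure ha hb fun _ => 1).symm

theorem betaPDFReal_mul_exp_logit {a b t : ℝ} (c : ℝ) (ha : 0 < a + t) (hb : 0 < b - t) {p : ℝ}
    (hp : p ∈ Ioo (0 : ℝ) 1) :
    betaPDFReal a b p * Real.exp (t * (Real.log p - Real.log (1 - p) - c)) =
      Real.exp (-(t * c)) * (beta (a + t) (b - t) / beta a b) * betaPDFReal (a + t) (b - t) p := by
  have hq : 0 < 1 - p := by linarith [hp.2]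
  rw [betaPDFReal, betaPDFReal, if_pos ⟨hp.1, hp.2⟩, if_pos ⟨hp.1, hp.2⟩,
    Real.rpow_def_of_pos hp.1, Real.rpow_def_of_pos hq, Real.rpow_def_of_pos hp.1,
    Real.rpow_def_of_pos hq]
  have h1 : t * (Real.log p - Real.log (1 - p) - c) =
    t * Real.log p + (-t) * Real.log (1 - p) + -(t * c) := by ring
  have h2 : Real.log p * (a + t - 1) = Real.log p * (a - 1) + t * Real.log p := by ring
  have h3 : Real.log (1 - p) * (b - t - 1) =
      Real.log (1 - p) * (b - 1) + (-t) * Real.log (1 - p) := by ring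
  rw [h1, h2, h3]
  simp only [Real.exp_add]
  have := (beta_pos ha hb).ne'
  field_simp

theorem integrable_exp_logit {a b t : ℝ} (c : ℝ) (ha : 0 < a) (hb : 0 < b) (hat : 0 < a + t)
    (hbt : 0 < b - t) :
    Integrable (fun p => Real.exp (t * (Real.log p - Real.log (1 - p) - c)))
      (betaMeasure a b) := by
  rw [integrable_betaMeasure_iff ha hb,
    integrableOn_congr_fun (fun p hp => betaPDFReal_mul_exp_logit c hat hbt hp) measurableSet_Ioo]
  exact (integrable_one_beta hat hbt).const_mul _

theorem mgf_logit {a b t : ℝ} (c : ℝ) (ha : 0 < a) (hb : 0 < b) (hat : 0 < a + t)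
    (hbt : 0 < b - t) :
    mgf (fun p => Real.log p - Real.log (1 - p) - c) (betaMeasure a b) t =
      Real.exp (-(t * c)) * (beta (a + t) (b - t) / beta a b) := by
  rw [mgf, integral_betaMeasure ha hb, setIntegral_congr_fun measurableSet_Ioo
    (fun p hp => betaPDFReal_mul_exp_logit c hat hbt hp), integral_const_mul,
    integral_one_beta hat hbt, mul_one]

theorem cgf_logit {a b t : ℝ} (c : ℝ) (ha : 0 < a) (hb : 0 < b) (hat : 0 < a + t)
    (hbt : 0 < b - t) :
    cgf (fun p => Real.log p - Real.log (1 - p) - c) (betaMeasure a b) t =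
      logGamma (a + t) + logGamma (b - t) - t * c - (logGamma a + logGamma b) := by
  have h1 := (Real.Gamma_pos_of_pos hat).ne'
  have h2 := (Real.Gamma_pos_of_pos hbt).ne'
  have h3 := (Real.Gamma_pos_of_pos ha).ne'
  have h4 := (Real.Gamma_pos_of_pos hb).ne'
  have h5 := (Real.Gamma_pos_of_pos (add_pos ha hb)).ne'
  have h6 : beta (a + t) (b - t) / beta a b =
      Real.Gamma (a + t) * Real.Gamma (b - t) / (Real.Gamma a * Real.Gamma b) := by
    rw [beta, beta, show a + t + (b - t) = a + b by ring]
    field_simp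
  rw [cgf, mgf_logit c ha hb hat hbt, h6,
    Real.log_mul (Real.exp_pos _).ne' (div_ne_zero (mul_ne_zero h1 h2) (mul_ne_zero h3 h4)),
    Real.log_exp, Real.log_div (mul_ne_zero h1 h2) (mul_ne_zero h3 h4), Real.log_mul h1 h2,
    Real.log_mul h3 h4]
  simp only [logGamma]
  ring

/-- The second moment of the centred log-odds under a beta distribution. -/
theorem integral_sq_logit {a b : ℝ} (c : ℝ) (ha : 0 < a) (hb : 0 < b) :
    ∫ p, (Real.log p - Real.log (1 - p) - c) ^ 2 ∂betaMeasure a b =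
      deriv digamma a + deriv digamma b + (digamma a - digamma b - c) ^ 2 := by
  have := isProbabilityMeasureBeta ha hb
  set X : ℝ → ℝ := fun p => Real.log p - Real.log (1 - p) - c
  have hsub : Ioo (-a) b ⊆ integrableExpSet X (betaMeasure a b) := fun t ht =>
    integrable_exp_logit c ha hb (neg_lt_iff_pos_add'.1 ht.1) (sub_pos.2 ht.2)
  have hmem : (0 : ℝ) ∈ Ioo (-a) b := ⟨neg_lt_zero.2 ha, hb⟩
  have h0 : (0 : ℝ) ∈ interior (integrableExpSet X (betaMeasure a b)) :=
    interior_maximal hsub isOpen_Ioo hmem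
  have hnhds : ∀ t ∈ Ioo (-a) b, Ioo (-a) b ∈ 𝓝 t := fun t ht => isOpen_Ioo.mem_nhds ht
  have hderiv : ∀ t ∈ Ioo (-a) b, HasDerivAt (cgf X (betaMeasure a b))
      (digamma (a + t) - digamma (b - t) - c) t := fun t ht => by
    have h1 : HasDerivAt (fun t => logGamma (a + t)) (digamma (a + t)) t :=
      (hasDerivAt_logGamma (by linarith [ht.1])).comp_const_add a t
    have h2 : HasDerivAt (fun t => logGamma (b - t)) (-digamma (b - t)) t :=
      (hasDerivAt_logGamma (by linarith [ht.2])).comp_const_sub b t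
    have h3 := (((h1.add h2).sub ((hasDerivAt_id t).mul_const c)).sub_const
      (logGamma a + logGamma b)).congr_of_eventuallyEq (f₁ := cgf X (betaMeasure a b)) (by
        filter_upwards [hnhds t ht] with s hs
        exact cgf_logit c ha hb (by linarith [hs.1]) (by linarith [hs.2]))
    exact h3.congr_deriv (by ring)
  have hderiv2 : HasDerivAt (deriv (cgf X (betaMeasure a b)))
      (deriv digamma a + deriv digamma b) 0 := by
    have h1 : HasDerivAt (fun t => digamma (a + t)) (deriv digamma (a + 0)) 0 :=
      (hasDerivAt_digamma (by linarith)).comp_const_add a 0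
    have h2 : HasDerivAt (fun t => digamma (b - t)) (-deriv digamma (b - 0)) 0 :=
      (hasDerivAt_digamma (by linarith)).comp_const_sub b 0
    have h3 := ((h1.sub h2).sub_const c).congr_of_eventuallyEq
      (f₁ := deriv (cgf X (betaMeasure a b))) (by
        filter_upwards [hnhds 0 hmem] with s hs
        exact (hderiv s hs).deriv)
    simpa using h3
  have h := iteratedDeriv_two_cgf h0
  rw [iteratedDeriv_succ, iteratedDeriv_one, hderiv2.deriv, (hderiv 0 hmem).deriv] at h
  simp only [zero_mul, Real.exp_zero, mul_one, mgf_zero, div_one, add_zero, sub_zero] at h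
  linarith

theorem deriv_digamma_nonneg {x : ℝ} (hx : 0 < x) : 0 ≤ deriv digamma x := by
  have h := integral_sq_logit 0 hx hx
  have h2 : 0 ≤ ∫ p, (Real.log p - Real.log (1 - p) - 0) ^ 2 ∂betaMeasure x x :=
    integral_nonneg fun p => sq_nonneg _
  rw [h] at h2
  simp at h2
  linarith

theorem deriv_digamma_le {x : ℝ} (hx : 1 < x) : deriv digamma x ≤ 1 / (x - 1) := by
  have hx0 : 0 < x := by linarith
  have := isProbabilityMeasureBeta hx0 hx0
  have h := integral_sq_logit 0 hx0 hx0
  have i1 := integrable_exp_logit (t := 1) 0 hx0 hx0 (by linarith) (by linarith)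
  have i2 := integrable_exp_logit (t := -1) 0 hx0 hx0 (by linarith) (by linarith)
  have m1 := mgf_logit (t := 1) 0 hx0 hx0 (by linarith) (by linarith)
  have m2 := mgf_logit (t := -1) 0 hx0 hx0 (by linarith) (by linarith)
  rw [mgf] at m1 m2
  have hcosh (y : ℝ) : y ^ 2 ≤ Real.exp (1 * y) + Real.exp (-1 * y) - 2 := by
    have h1 : (y / 2) ^ 2 ≤ Real.sinh (y / 2) ^ 2 := by
      rw [sq_le_sq, Real.abs_sinh]
      exact Real.self_le_sinh_iff.2 (abs_nonneg _)
    have h2 : Real.exp (y / 2) * Real.exp (-(y / 2)) = 1 := by simp [← Real.exp_add]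
    rw [Real.sinh_eq] at h1
    rw [show 1 * y = y / 2 + y / 2 by ring, show -1 * y = -(y / 2) + -(y / 2) by ring,
      Real.exp_add, Real.exp_add]
    nlinarith
  have hle := integral_mono_of_nonneg (μ := betaMeasure x x)
    (ae_of_all _ fun p => sq_nonneg (Real.log p - Real.log (1 - p) - 0))
    ((i1.add i2).sub (integrable_const 2)) (ae_of_all _ fun p => hcosh _)
  have hG : Real.Gamma x = (x - 1) * Real.Gamma (x - 1) := by
    have := Real.Gamma_add_one (s := x - 1) (by linarith)
    rwa [sub_add_cancel] at this
  have hb : beta (x + 1) (x - 1) / beta x x = x / (x - 1) := by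
    have := (Real.Gamma_pos_of_pos (by linarith : 0 < x - 1)).ne'
    have := (Real.Gamma_pos_of_pos (by linarith : 0 < x + x)).ne'
    have : x - 1 ≠ 0 := by linarith
    rw [beta, beta, Real.Gamma_add_one hx0.ne', show x + 1 + (x - 1) = x + x by ring, hG]
    field_simp
  have hb' : beta (x + -1) (x - -1) / beta x x = x / (x - 1) := by
    rw [← hb, sub_neg_eq_add, ← sub_eq_add_neg, beta, beta, beta,
      mul_comm (Real.Gamma (x - 1)), add_comm (x - 1)]
  have hI : ∫ p, (Real.exp (1 * (Real.log p - Real.log (1 - p) - 0)) +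
      Real.exp (-1 * (Real.log p - Real.log (1 - p) - 0)) - 2) ∂betaMeasure x x =
      x / (x - 1) + x / (x - 1) - 2 := by
    rw [integral_sub (by exact i1.add i2) (integrable_const 2), integral_add i1 i2, m1, m2, hb,
      hb']
    simp
  have h3 := hle.trans_eq hI
  rw [h] at h3
  have : x / (x - 1) = 1 + 1 / (x - 1) := by
    have : x - 1 ≠ 0 := by linarith
    field_simp
    ring
  simp at h3 this ⊢
  linarith

theorem log_sub_one_le_digamma {x : ℝ} (hx : 1 < x) : Real.log (x - 1) ≤ digamma x := by
  have hconv : ConvexOn ℝ (Ioi 0) logGamma := Real.convexOn_log_Gamma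
  have h := hconv.slope_le_of_hasDerivAt (mem_Ioi.2 (sub_pos.2 hx)) (mem_Ioi.2 (by linarith))
    (by linarith) (hasDerivAt_logGamma (by linarith : 0 < x))
  have h1 := logGamma_add_one (sub_pos.2 hx)
  rw [sub_add_cancel] at h1
  rwa [slope_def_field, h1, add_sub_cancel_right, sub_sub_cancel, div_one] at h

theorem log_add_one_sub_log_le {x : ℝ} (hx : 0 < x) :
    Real.log (x + 1) - Real.log x ≤ (1 / x + 1 / (x + 1)) / 2 := by
  have hy : 0 < (x + 1) / x := by positivity
  have h := Real.self_le_sinh_iff.2 (Real.log_nonneg (x := (x + 1) / x) (by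
    rw [le_div_iff₀ hx]; linarith))
  rw [Real.sinh_log hy, Real.log_div (by positivity) hx.ne'] at h
  refine h.trans_eq ?_
  field_simp
  ring

theorem le_log_add_one_sub_log {x : ℝ} (hx : 0 < x) :
    2 / (2 * x + 1) ≤ Real.log (x + 1) - Real.log x := by
  have h := Real.le_log_one_add_of_nonneg (x := 1 / x) (by positivity)
  rw [show 1 + 1 / x = (x + 1) / x by field_simp, Real.log_div (by positivity) hx.ne'] at h
  refine le_trans (le_of_eq ?_) h
  field_simp
  ring

theorem tendsto_deriv_digamma : Tendsto (deriv digamma) atTop (𝓝 0) := by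
  have h : Tendsto (fun x : ℝ => 1 / (x - 1)) atTop (𝓝 0) :=
    tendsto_const_nhds.div_atTop (tendsto_atTop_add_const_right _ _ tendsto_id)
  refine tendsto_of_tendsto_of_tendsto_of_le_of_le' tendsto_const_nhds h ?_ ?_
  · filter_upwards [eventually_gt_atTop 0] with x hx using deriv_digamma_nonneg hx
  · filter_upwards [eventually_gt_atTop 1] with x hx using deriv_digamma_le hx

theorem tendsto_digamma_sub_log : Tendsto (fun x => digamma x - Real.log x) atTop (𝓝 0) := by
  have h : Tendsto (fun x : ℝ => -(1 / (x - 1))) atTop (𝓝 0) := by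
    rw [← neg_zero]
    exact (tendsto_const_nhds.div_atTop (tendsto_atTop_add_const_right _ _ tendsto_id)).neg
  refine tendsto_of_tendsto_of_tendsto_of_le_of_le' h tendsto_const_nhds ?_ ?_
  · filter_upwards [eventually_gt_atTop 1] with x hx
    have hx1 : 0 < x - 1 := sub_pos.2 hx
    have h1 := log_sub_one_le_digamma hx
    have h2 := Real.log_le_sub_one_of_pos (x := x / (x - 1)) (by positivity)
    rw [Real.log_div (by positivity) hx1.ne'] at h2
    have h3 : x / (x - 1) - 1 = 1 / (x - 1) := by
      field_simp
      ring
    linarith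
  · filter_upwards [eventually_gt_atTop 0] with x hx
    linarith [digamma_le_log hx]

theorem tendsto_const_div_pow_atTop (k c : ℝ) {m : ℕ} (hm : m ≠ 0) (hc : 0 < c) :
    Tendsto (fun x : ℝ => k / (c * x ^ m)) atTop (𝓝 0) :=
  tendsto_const_nhds.div_atTop ((tendsto_pow_atTop hm).const_mul_atTop hc)

theorem digamma_le {x : ℝ} (hx : 0 < x) : digamma x ≤ Real.log x - 1 / (2 * x ^ 1) := by
  have key := nonneg_of_antitone_step (F := fun x => -(digamma x - Real.log x) - 1 / (2 * x ^ 1))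
    (fun x hx => ?_) ?_ hx
  · linarith
  · have h1 := digamma_add_one hx
    have h2 := log_add_one_sub_log_le hx
    have h3 : 1 / (2 * (x + 1) ^ 1) = 1 / (x + 1) / 2 := by field_simp
    have h4 : 1 / (2 * x ^ 1) = 1 / x / 2 := by field_simp
    rw [h3, h4]
    linarith
  · simpa using tendsto_digamma_sub_log.neg.sub
      (tendsto_const_div_pow_atTop 1 2 one_ne_zero two_pos)

theorem le_digamma {x : ℝ} (hx : 0 < x) :
    Real.log x - 1 / (2 * x ^ 1) - 1 / (8 * x ^ 2) ≤ digamma x := by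
  have key := nonneg_of_antitone_step
    (F := fun x => digamma x - Real.log x + 1 / (2 * x ^ 1) + 1 / (8 * x ^ 2))
    (fun x hx => ?_) ?_ hx
  · linarith
  · have h1 := digamma_add_one hx
    have h2 := le_log_add_one_sub_log hx
    have h3 : 1 / x + 1 / (2 * (x + 1) ^ 1) + 1 / (8 * (x + 1) ^ 2) ≤
        2 / (2 * x + 1) + 1 / (2 * x ^ 1) + 1 / (8 * x ^ 2) := by
      have : 2 / (2 * x + 1) + 1 / (2 * x ^ 1) + 1 / (8 * x ^ 2) -
          (1 / x + 1 / (2 * (x + 1) ^ 1) + 1 / (8 * (x + 1) ^ 2)) =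
          1 / (8 * x ^ 2 * (x + 1) ^ 2 * (2 * x + 1)) := by
        field_simp
        ring
      have h4 : 0 ≤ 1 / (8 * x ^ 2 * (x + 1) ^ 2 * (2 * x + 1)) := by positivity
      linarith
    linarith
  · simpa using (tendsto_digamma_sub_log.add
      (tendsto_const_div_pow_atTop 1 2 one_ne_zero two_pos)).add
      (tendsto_const_div_pow_atTop 1 8 two_ne_zero (by norm_num))

theorem le_deriv_digamma {x : ℝ} (hx : 0 < x) :
    1 / (1 * x ^ 1) + 1 / (2 * x ^ 2) ≤ deriv digamma x := by
  have key := nonneg_of_antitone_step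
    (F := fun x => deriv digamma x - 1 / (1 * x ^ 1) - 1 / (2 * x ^ 2)) (fun x hx => ?_) ?_ hx
  · linarith
  · simp only [deriv_digamma_add_one hx]
    have : 1 / (1 * (x + 1) ^ 1) + 1 / (2 * (x + 1) ^ 2) -
        (1 / (1 * x ^ 1) + 1 / (2 * x ^ 2)) + 1 / x ^ 2 = 1 / (2 * x ^ 2 * (x + 1) ^ 2) := by
      field_simp
      ring
    have h4 : 0 ≤ 1 / (2 * x ^ 2 * (x + 1) ^ 2) := by positivity
    linarith
  · simpa using (tendsto_deriv_digamma.sub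
      (tendsto_const_div_pow_atTop 1 1 one_ne_zero one_pos)).sub
      (tendsto_const_div_pow_atTop 1 2 two_ne_zero two_pos)

theorem deriv_digamma_le_sharp {x : ℝ} (hx : 0 < x) :
    deriv digamma x ≤ 1 / (1 * x ^ 1) + 1 / (2 * x ^ 2) + 1 / (6 * x ^ 3) := by
  have key := nonneg_of_antitone_step
    (F := fun x => 1 / (1 * x ^ 1) + 1 / (2 * x ^ 2) + 1 / (6 * x ^ 3) - deriv digamma x)
    (fun x hx => ?_) ?_ hx
  · linarith
  · simp only [deriv_digamma_add_one hx]
    have : 1 / (1 * x ^ 1) + 1 / (2 * x ^ 2) + 1 / (6 * x ^ 3) -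
        (1 / (1 * (x + 1) ^ 1) + 1 / (2 * (x + 1) ^ 2) + 1 / (6 * (x + 1) ^ 3)) - 1 / x ^ 2 =
        1 / (6 * x ^ 3 * (x + 1) ^ 3) := by
      field_simp
      ring
    have h4 : 0 ≤ 1 / (6 * x ^ 3 * (x + 1) ^ 3) := by positivity
    linarith
  · simpa using (((tendsto_const_div_pow_atTop 1 1 one_ne_zero one_pos).add
      (tendsto_const_div_pow_atTop 1 2 two_ne_zero two_pos)).add
      (tendsto_const_div_pow_atTop 1 6 three_ne_zero (by norm_num))).sub tendsto_deriv_digamma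

theorem tendsto_add_mul_inv_add_inv_sq (c g : ℝ) :
    Tendsto (fun s : ℝ => c + g * s⁻¹ + s⁻¹ ^ 2) atTop (𝓝 c) := by
  have h := (tendsto_const_nhds (x := c)).add ((tendsto_inv_atTop_zero (𝕜 := ℝ)).const_mul g)
  simpa using h.add (tendsto_inv_atTop_zero.pow 2)

theorem quadratic_eq_sq_mul {s : ℝ} (hs : 0 < s) (c g : ℝ) :
    c * s ^ 2 + g * s + 1 = s ^ 2 * (c + g * s⁻¹ + s⁻¹ ^ 2) := by
  field_simp

theorem tendsto_pow_four_mul_deriv_digamma {c : ℝ} (hc : 0 < c) (g : ℝ) :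
    Tendsto (fun s : ℝ =>
        s ^ 4 * deriv digamma (c * s ^ 2 + g * s + 1) - s ^ 2 / c + s * g / c ^ 2)
      atTop (𝓝 ((g ^ 2 - c) / (c ^ 2 * c) + 1 / (2 * c ^ 2))) := by
  have hq := tendsto_add_mul_inv_add_inv_sq c g
  have hi := tendsto_inv_atTop_zero (𝕜 := ℝ)
  have hqpos := hq.eventually (lt_mem_nhds hc)
  have hmain : Tendsto (fun s : ℝ => (g ^ 2 - c + g * s⁻¹) / (c ^ 2 * (c + g * s⁻¹ + s⁻¹ ^ 2)) +
      1 / (2 * (c + g * s⁻¹ + s⁻¹ ^ 2) ^ 2)) atTop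
      (𝓝 ((g ^ 2 - c + g * 0) / (c ^ 2 * c) + 1 / (2 * c ^ 2))) :=
    ((tendsto_const_nhds.add (hi.const_mul g)).div (hq.const_mul _) (by positivity)).add
      (tendsto_const_nhds.div ((hq.pow 2).const_mul 2) (by positivity))
  have herr : Tendsto (fun s : ℝ => s⁻¹ ^ 2 / (6 * (c + g * s⁻¹ + s⁻¹ ^ 2) ^ 3)) atTop
      (𝓝 (0 ^ 2 / (6 * c ^ 3))) :=
    (hi.pow 2).div ((hq.pow 3).const_mul 6) (by positivity)
  have hupper := hmain.add herr
  rw [mul_zero, add_zero] at hmain hupper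
  rw [zero_pow two_ne_zero, zero_div, add_zero] at hupper
  refine tendsto_of_tendsto_of_tendsto_of_le_of_le' hmain hupper ?_ ?_
  · filter_upwards [hqpos, eventually_gt_atTop 0] with s hs0 hs
    have hx := quadratic_eq_sq_mul hs c g
    rw [hx]
    set q := c + g * s⁻¹ + s⁻¹ ^ 2 with hqdef
    have h := mul_le_mul_of_nonneg_left (le_deriv_digamma (by positivity : 0 < s ^ 2 * q))
      (by positivity : 0 ≤ s ^ 4)
    have he : s ^ 4 * (1 / (1 * (s ^ 2 * q) ^ 1) + 1 / (2 * (s ^ 2 * q) ^ 2)) =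
        s ^ 2 / q + 1 / (2 * q ^ 2) := by
      field_simp
    have hg : (g ^ 2 - c + g * s⁻¹) / (c ^ 2 * q) = s ^ 2 / q - s ^ 2 / c + s * g / c ^ 2 := by
      rw [eq_comm, eq_div_iff (by positivity)]
      field_simp
      rw [hqdef]
      field_simp
      ring
    linarith
  · filter_upwards [hqpos, eventually_gt_atTop 0] with s hs0 hs
    have hx := quadratic_eq_sq_mul hs c g
    rw [hx]
    set q := c + g * s⁻¹ + s⁻¹ ^ 2 with hqdef
    have h := mul_le_mul_of_nonneg_left (deriv_digamma_le_sharp (by positivity : 0 < s ^ 2 * q))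
      (by positivity : 0 ≤ s ^ 4)
    have he : s ^ 4 * (1 / (1 * (s ^ 2 * q) ^ 1) + 1 / (2 * (s ^ 2 * q) ^ 2) +
        1 / (6 * (s ^ 2 * q) ^ 3)) = s ^ 2 / q + 1 / (2 * q ^ 2) + s⁻¹ ^ 2 / (6 * q ^ 3) := by
      field_simp
    have hg : (g ^ 2 - c + g * s⁻¹) / (c ^ 2 * q) = s ^ 2 / q - s ^ 2 / c + s * g / c ^ 2 := by
      rw [eq_comm, eq_div_iff (by positivity)]
      field_simp
      rw [hqdef]
      field_simp
      ring
    linarith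

theorem tendsto_pow_three_mul_digamma_sub_log {c : ℝ} (hc : 0 < c) (g : ℝ) :
    Tendsto (fun s : ℝ => s ^ 3 * (digamma (c * s ^ 2 + g * s + 1) -
      Real.log (c * s ^ 2 + g * s + 1) + 1 / (2 * (c * s ^ 2 + g * s + 1)))) atTop (𝓝 0) := by
  have hq := tendsto_add_mul_inv_add_inv_sq c g
  have herr : Tendsto (fun s : ℝ => -(s⁻¹ / (8 * (c + g * s⁻¹ + s⁻¹ ^ 2) ^ 2))) atTop (𝓝 0) := by
    simpa using ((tendsto_inv_atTop_zero (𝕜 := ℝ)).div ((hq.pow 2).const_mul 8)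
      (by positivity)).neg
  refine tendsto_of_tendsto_of_tendsto_of_le_of_le' herr tendsto_const_nhds ?_ ?_
  · filter_upwards [hq.eventually (lt_mem_nhds hc), eventually_gt_atTop 0] with s hs0 hs
    rw [quadratic_eq_sq_mul hs c g]
    set q := c + g * s⁻¹ + s⁻¹ ^ 2
    have h := le_digamma (by positivity : 0 < s ^ 2 * q)
    rw [pow_one] at h
    have h1 : -(s⁻¹ / (8 * q ^ 2)) = s ^ 3 * -(1 / (8 * (s ^ 2 * q) ^ 2)) := by
      field_simp
    rw [h1]
    exact mul_le_mul_of_nonneg_left (by linarith) (by positivity)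
  · filter_upwards [hq.eventually (lt_mem_nhds hc), eventually_gt_atTop 0] with s hs0 hs
    rw [quadratic_eq_sq_mul hs c g]
    have h := digamma_le (by positivity : 0 < s ^ 2 * (c + g * s⁻¹ + s⁻¹ ^ 2))
    rw [pow_one] at h
    exact mul_nonpos_of_nonneg_of_nonpos (by positivity) (by linarith)

theorem tendsto_pow_three_mul_log_remainder {c : ℝ} (hc : 0 < c) (g : ℝ) :
    Tendsto (fun s : ℝ => s ^ 3 * (Real.log (1 + g * s⁻¹ / (c + s⁻¹ ^ 2)) -
      (g * s⁻¹ / (c + s⁻¹ ^ 2) - (g * s⁻¹ / (c + s⁻¹ ^ 2)) ^ 2 / 2 +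
        (g * s⁻¹ / (c + s⁻¹ ^ 2)) ^ 3 / 3))) atTop (𝓝 0) := by
  have hi := tendsto_inv_atTop_zero (𝕜 := ℝ)
  have hq : Tendsto (fun s : ℝ => c + s⁻¹ ^ 2) atTop (𝓝 c) := by
    simpa using tendsto_add_mul_inv_add_inv_sq c 0
  have hw : Tendsto (fun s : ℝ => g * s⁻¹ / (c + s⁻¹ ^ 2)) atTop (𝓝 0) := by
    have h1 := (hi.const_mul g).div hq hc.ne'
    rwa [mul_zero, zero_div] at h1
  have hwabs : Tendsto (fun s : ℝ => |g * s⁻¹ / (c + s⁻¹ ^ 2)|) atTop (𝓝 0) := by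
    simpa using hw.abs
  have hbound : Tendsto (fun s : ℝ => |s⁻¹| * (|g| / |c + s⁻¹ ^ 2|) ^ 4 /
      (1 - |g * s⁻¹ / (c + s⁻¹ ^ 2)|)) atTop (𝓝 0) := by
    have h1 := (hi.abs.mul (((tendsto_const_nhds (x := |g|)).div hq.abs
      (abs_pos.2 hc.ne').ne').pow 4)).div ((tendsto_const_nhds (x := (1 : ℝ))).sub hwabs)
      (by norm_num)
    rwa [abs_zero, zero_mul, zero_div] at h1
  refine squeeze_zero_norm' ?_ hbound
  filter_upwards [hwabs.eventually (gt_mem_nhds one_pos), eventually_gt_atTop 0] with s hs1 hs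
  set w := g * s⁻¹ / (c + s⁻¹ ^ 2) with hwdef
  have h := Real.abs_log_sub_add_sum_range_le (x := -w) (by rwa [abs_neg]) 3
  simp only [Finset.sum_range_succ, Finset.sum_range_zero, abs_neg, sub_neg_eq_add] at h
  rw [Real.norm_eq_abs, abs_mul]
  calc |s ^ 3| * |Real.log (1 + w) - (w - w ^ 2 / 2 + w ^ 3 / 3)|
      ≤ |s ^ 3| * (|w| ^ (3 + 1) / (1 - |w|)) := by
        refine mul_le_mul_of_nonneg_left (le_of_eq_of_le (congrArg _ ?_) h) (abs_nonneg _)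
        norm_num
        ring
    _ = |s⁻¹| * (|g| / |c + s⁻¹ ^ 2|) ^ 4 / (1 - |w|) := by
        rw [← mul_div_assoc]
        congr 1
        have h2 : |s| ^ 3 * |s|⁻¹ ^ 4 = |s|⁻¹ := by
          have : |s| ≠ 0 := abs_ne_zero.2 hs.ne'
          field_simp
        rw [hwdef, abs_div, abs_mul, abs_pow, abs_inv]
        calc |s| ^ 3 * (|g| * |s|⁻¹ / |c + s⁻¹ ^ 2|) ^ (3 + 1)
            = |s| ^ 3 * |s|⁻¹ ^ 4 * (|g| / |c + s⁻¹ ^ 2|) ^ 4 := by ring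
          _ = _ := by rw [h2]

theorem tendsto_pow_three_mul_digamma_sub {c : ℝ} (hc : 0 < c) (g : ℝ) :
    ∃ k, Tendsto (fun s : ℝ =>
      s ^ 3 * (digamma (c * s ^ 2 + g * s + 1) - digamma (c * s ^ 2 + 1)) -
      s ^ 2 * (g / c) + s * (g ^ 2 / (2 * c ^ 2))) atTop (𝓝 k) := by
  have hi := tendsto_inv_atTop_zero (𝕜 := ℝ)
  have hq := tendsto_add_mul_inv_add_inv_sq c g
  have hq0 : Tendsto (fun s : ℝ => c + s⁻¹ ^ 2) atTop (𝓝 c) := by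
    simpa using tendsto_add_mul_inv_add_inv_sq c 0
  have h1 := tendsto_pow_three_mul_digamma_sub_log hc g
  have h2 := tendsto_pow_three_mul_digamma_sub_log hc 0
  have h3 := tendsto_pow_three_mul_log_remainder hc g
  have h4 : Tendsto (fun s : ℝ => g / (2 * ((c + g * s⁻¹ + s⁻¹ ^ 2) * (c + s⁻¹ ^ 2)))) atTop
      (𝓝 (g / (2 * (c * c)))) :=
    tendsto_const_nhds.div ((hq.mul hq0).const_mul 2) (by positivity)
  have h5 : Tendsto (fun s : ℝ => -g / (c * (c + s⁻¹ ^ 2)) +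
      g ^ 2 * s⁻¹ * (2 * c + s⁻¹ ^ 2) / (2 * c ^ 2 * (c + s⁻¹ ^ 2) ^ 2) +
      g ^ 3 / (3 * (c + s⁻¹ ^ 2) ^ 3)) atTop
      (𝓝 (-g / (c * c) + g ^ 2 * 0 * (2 * c + 0 ^ 2) / (2 * c ^ 2 * c ^ 2) + g ^ 3 / (3 * c ^ 3))) :=
    ((tendsto_const_nhds.div (hq0.const_mul c) (by positivity)).add
      (((hi.const_mul (g ^ 2)).mul ((hi.pow 2).const_add (2 * c))).div
        ((hq0.pow 2).const_mul (2 * c ^ 2)) (by positivity))).add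
      (tendsto_const_nhds.div ((hq0.pow 3).const_mul 3) (by positivity))
  refine ⟨_, (((((h1.sub h2).add h3).add h4).add h5)).congr' ?_⟩
  filter_upwards [hq.eventually (lt_mem_nhds hc), hq0.eventually (lt_mem_nhds hc),
    eventually_gt_atTop 0] with s hs1 hs2 hs
  have hx0 : c * s ^ 2 + 0 * s + 1 = s ^ 2 * (c + s⁻¹ ^ 2) := by
    simpa using quadratic_eq_sq_mul hs c 0
  have hx0' : c * s ^ 2 + 1 = s ^ 2 * (c + s⁻¹ ^ 2) := by simpa using hx0
  have hlog : Real.log (1 + g * s⁻¹ / (c + s⁻¹ ^ 2)) =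
      Real.log (s ^ 2 * (c + g * s⁻¹ + s⁻¹ ^ 2)) - Real.log (s ^ 2 * (c + s⁻¹ ^ 2)) := by
    rw [← Real.log_div (by positivity) (by positivity),
      mul_div_mul_left _ _ (by positivity : s ^ 2 ≠ 0), eq_comm]
    congr 1
    rw [eq_comm, ← sub_eq_zero]
    field_simp
    ring
  rw [hx0, hx0', quadratic_eq_sq_mul hs c g, hlog]
  have e1 : s ^ 3 * (1 / (2 * (s ^ 2 * (c + g * s⁻¹ + s⁻¹ ^ 2))) -
      1 / (2 * (s ^ 2 * (c + s⁻¹ ^ 2)))) =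
      -(g / (2 * ((c + g * s⁻¹ + s⁻¹ ^ 2) * (c + s⁻¹ ^ 2)))) := by
    obtain ⟨q, hqe⟩ : ∃ q, q = c + s⁻¹ ^ 2 := ⟨_, rfl⟩
    have hqe' : c + g * s⁻¹ + s⁻¹ ^ 2 = q + g * s⁻¹ := by rw [hqe]; ring
    rw [hqe'] at hs1 ⊢
    rw [← hqe] at hs2 ⊢
    have hne : q * s + g ≠ 0 := by
      have := mul_pos hs1 hs
      rw [add_mul, inv_mul_cancel_right₀ hs.ne'] at this
      exact this.ne'
    have hne' : s * q + g ≠ 0 := by rwa [mul_comm s]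
    field_simp
    ring
  have e2 : s ^ 3 * (g * s⁻¹ / (c + s⁻¹ ^ 2) - (g * s⁻¹ / (c + s⁻¹ ^ 2)) ^ 2 / 2 +
        (g * s⁻¹ / (c + s⁻¹ ^ 2)) ^ 3 / 3) - s ^ 2 * (g / c) + s * (g ^ 2 / (2 * c ^ 2)) =
      -g / (c * (c + s⁻¹ ^ 2)) +
      g ^ 2 * s⁻¹ * (2 * c + s⁻¹ ^ 2) / (2 * c ^ 2 * (c + s⁻¹ ^ 2) ^ 2) +
      g ^ 3 / (3 * (c + s⁻¹ ^ 2) ^ 3) := by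
    have hne : c * s ^ 2 + 1 ≠ 0 := by positivity
    field_simp
    ring
  rw [← e2]
  linear_combination e1

theorem deriv_log_betaDensR (n : ℕ) {α p : ℝ} (hα : α ∈ Ioo (0 : ℝ) 1) (hp : p ∈ Ioo (0 : ℝ) 1) :
    deriv (fun a => Real.log (betaDensR n a p)) α =
      n * (Real.log p - Real.log (1 - p) -
        (digamma (α * n + 1) - digamma ((1 - α) * n + 1))) := by
  have hq : 0 < 1 - p := by linarith [hp.2]
  have hpos : ∀ a ∈ Ioo (0 : ℝ) 1, 0 < a * n + 1 ∧ 0 < (1 - a) * n + 1 := fun a ha => by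
    have := ha.1
    have : 0 < 1 - a := sub_pos.2 ha.2
    constructor <;> positivity
  have heq : (fun a => Real.log (betaDensR n a p)) =ᶠ[𝓝 α] fun a =>
      Real.log (Real.Gamma (n + 2)) - (logGamma (a * n + 1) + logGamma ((1 - a) * n + 1)) +
        a * n * Real.log p + (1 - a) * n * Real.log (1 - p) := by
    filter_upwards [isOpen_Ioo.mem_nhds hα] with a ha
    have h1 := (Real.Gamma_pos_of_pos (hpos a ha).1).ne'
    have h2 := (Real.Gamma_pos_of_pos (hpos a ha).2).ne'
    have h3 := (Real.Gamma_pos_of_pos (by positivity : 0 < (n : ℝ) + 2)).ne'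
    have h4 := (Real.rpow_pos_of_pos hp.1 (a * n)).ne'
    have h5 := (Real.rpow_pos_of_pos hq ((1 - a) * n)).ne'
    have h6 := div_ne_zero h3 (mul_ne_zero h1 h2)
    rw [betaDensR, Real.log_mul (mul_ne_zero h6 h4) h5, Real.log_mul h6 h4,
      Real.log_div h3 (mul_ne_zero h1 h2), Real.log_mul h1 h2, Real.log_rpow hp.1,
      Real.log_rpow hq]
    rfl
  have hid : HasDerivAt (fun a : ℝ => a * n) n α := by
    simpa using (hasDerivAt_id α).mul_const (n : ℝ)
  have hid' : HasDerivAt (fun a : ℝ => (1 - a) * n) (-n) α := by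
    simpa using ((hasDerivAt_id α).const_sub 1).mul_const (n : ℝ)
  have d1 : HasDerivAt (fun a : ℝ => logGamma (a * n + 1)) (digamma (α * n + 1) * n) α :=
    HasDerivAt.comp (h₂ := logGamma) α (hasDerivAt_logGamma (hpos α hα).1) (hid.add_const 1)
  have d2 : HasDerivAt (fun a : ℝ => logGamma ((1 - a) * n + 1))
      (digamma ((1 - α) * n + 1) * -n) α :=
    HasDerivAt.comp (h₂ := logGamma) α (hasDerivAt_logGamma (hpos α hα).2) (hid'.add_const 1)
  have d := ((((d1.add d2).const_sub (Real.log (Real.Gamma (n + 2)))).add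
    (hid.mul_const (Real.log p))).add (hid'.mul_const (Real.log (1 - p)))).congr_of_eventuallyEq heq
  rw [d.deriv]
  ring

theorem weightPhiR_mul_betaDensR (n : ℕ) {α γ p : ℝ} (hα : α ∈ Ioo (0 : ℝ) 1)
    (hp : p ∈ Ioo (0 : ℝ) 1) :
    weightPhiR n α γ p * betaDensR n α p =
      betaPDFReal (α * n + γ * Real.sqrt n + 1) ((1 - α) * n + (1 - γ) * Real.sqrt n + 1) p := by
  have hq : 0 < 1 - p := by linarith [hp.2]
  have := hα.1
  have : 0 < 1 - α := sub_pos.2 hα.2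
  have h1 := (Real.Gamma_pos_of_pos (by positivity : 0 < α * n + 1)).ne'
  have h2 := (Real.Gamma_pos_of_pos (by positivity : 0 < (1 - α) * n + 1)).ne'
  have h3 := (Real.Gamma_pos_of_pos (by positivity : 0 < (n : ℝ) + 2)).ne'
  have e1 : p ^ (α * n + γ * Real.sqrt n + 1 - 1) = p ^ (γ * Real.sqrt n) * p ^ (α * n) := by
    rw [← Real.rpow_add hp.1]
    ring_nf
  have e2 : (1 - p) ^ ((1 - α) * n + (1 - γ) * Real.sqrt n + 1 - 1) =
      (1 - p) ^ ((1 - γ) * Real.sqrt n) * (1 - p) ^ ((1 - α) * n) := by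
    rw [← Real.rpow_add hq]
    ring_nf
  have e3 : 1 / beta (α * n + γ * Real.sqrt n + 1) ((1 - α) * n + (1 - γ) * Real.sqrt n + 1) =
      weightLambdaR n α γ *
        (Real.Gamma (n + 2) / (Real.Gamma (α * n + 1) * Real.Gamma ((1 - α) * n + 1))) := by
    rw [beta, weightLambdaR, one_div_div,
      show α * n + γ * Real.sqrt n + 1 + ((1 - α) * n + (1 - γ) * Real.sqrt n + 1) =
        n + 2 + Real.sqrt n by ring,
      show (1 - α) * n + (1 - γ) * Real.sqrt n + 1 = (1 - α) * n + 1 + (1 - γ) * Real.sqrt n by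
        ring]
    field_simp
  rw [weightPhiR, betaDensR, betaPDFReal, if_pos ⟨hp.1, hp.2⟩, e1, e2, e3]
  ring

theorem weightedFisherInfo_eq (n : ℕ) {α γ : ℝ} (hα : α ∈ Ioo (0 : ℝ) 1)
    (hγ : γ ∈ Ioo (0 : ℝ) 1) :
    weightedFisherInfo n α γ = (n : ℝ) ^ 2 *
      (deriv digamma (α * n + γ * Real.sqrt n + 1) +
        deriv digamma ((1 - α) * n + (1 - γ) * Real.sqrt n + 1) +
        (digamma (α * n + γ * Real.sqrt n + 1) -
          digamma ((1 - α) * n + (1 - γ) * Real.sqrt n + 1) -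
          (digamma (α * n + 1) - digamma ((1 - α) * n + 1))) ^ 2) := by
  have := hα.1
  have := hγ.1
  have : 0 < 1 - α := sub_pos.2 hα.2
  have : 0 < 1 - γ := sub_pos.2 hγ.2
  have ha : 0 < α * n + γ * Real.sqrt n + 1 := by positivity
  have hb : 0 < (1 - α) * n + (1 - γ) * Real.sqrt n + 1 := by positivity
  rw [← integral_sq_logit _ ha hb, integral_betaMeasure ha hb, ← integral_const_mul,
    weightedFisherInfo]
  refine setIntegral_congr_fun measurableSet_Ioo fun p hp => ?_
  rw [← weightPhiR_mul_betaDensR n hα hp, deriv_log_betaDensR n hα hp]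
  ring

/-- For `α, γ ∈ (0,1)`, with
`A = 1/(α(1-α)) + (α-γ)²/(α²(1-α)²)` and
`B = (2αγ - γ - α²)/((1-α)²α²) + (α-γ)²(α(2γ-1) - γ)/((1-α)³α³)`,
there is a constant `C(α,γ)` with `I_n^φ(α) - A n - B √n → C(α,γ)`. -/
theorem weighted_fisher_information_asymptotics
    (α γ : ℝ) (hα : α ∈ Set.Ioo (0 : ℝ) 1) (hγ : γ ∈ Set.Ioo (0 : ℝ) 1) :
    ∃ C : ℝ,
      Tendsto (fun n : ℕ =>
          weightedFisherInfo n α γ -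
            (1 / (α * (1 - α)) + (α - γ) ^ 2 / (α ^ 2 * (1 - α) ^ 2)) * n -
            ((2 * α * γ - γ - α ^ 2) / ((1 - α) ^ 2 * α ^ 2) +
              (α - γ) ^ 2 * (α * (2 * γ - 1) - γ) / ((1 - α) ^ 3 * α ^ 3)) * Real.sqrt n)
        atTop (nhds C) := by
  have hα0 : 0 < α := hα.1
  have hα1 : 0 < 1 - α := sub_pos.2 hα.2
  have t1 := tendsto_pow_four_mul_deriv_digamma hα0 γ
  have t2 := tendsto_pow_four_mul_deriv_digamma hα1 (1 - γ)
  obtain ⟨k1, h1⟩ := tendsto_pow_three_mul_digamma_sub hα0 γ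
  obtain ⟨k2, h2⟩ := tendsto_pow_three_mul_digamma_sub hα1 (1 - γ)
  have hi := tendsto_inv_atTop_zero (𝕜 := ℝ)
  have hR := h1.sub h2
  obtain ⟨d₁, hd₁⟩ : ∃ d, d = γ / α - (1 - γ) / (1 - α) := ⟨_, rfl⟩
  obtain ⟨d₂, hd₂⟩ : ∃ d, d = γ ^ 2 / (2 * α ^ 2) - (1 - γ) ^ 2 / (2 * (1 - α) ^ 2) := ⟨_, rfl⟩
  have hlim := (t1.add t2).add
    (((hR.const_mul (2 * d₁)).add ((hR.mul hi).const_mul (-2 * d₂))).add ((hR.mul hi).pow 2))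
  have hs : Tendsto (fun n : ℕ => Real.sqrt n) atTop atTop :=
    Real.tendsto_sqrt_atTop.comp tendsto_natCast_atTop_atTop
  refine ⟨_, ((hlim.comp hs).add_const (d₂ ^ 2)).congr' ?_⟩
  filter_upwards [eventually_gt_atTop 0] with n hn
  have hspos : 0 < Real.sqrt n := Real.sqrt_pos.2 (by exact_mod_cast hn)
  rw [weightedFisherInfo_eq n hα hγ]
  obtain ⟨s, hsn⟩ : ∃ s, s = Real.sqrt n := ⟨_, rfl⟩
  have hn2 : (n : ℝ) = s ^ 2 := by rw [hsn, Real.sq_sqrt n.cast_nonneg]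
  simp only [Function.comp_apply]
  rw [← hsn] at hspos ⊢
  rw [hn2]
  generalize deriv digamma (α * s ^ 2 + γ * s + 1) = x₁
  generalize deriv digamma ((1 - α) * s ^ 2 + (1 - γ) * s + 1) = x₂
  generalize digamma (α * s ^ 2 + γ * s + 1) = y₁
  generalize digamma ((1 - α) * s ^ 2 + (1 - γ) * s + 1) = y₂
  generalize digamma (α * s ^ 2 + 1) = y₃
  generalize digamma ((1 - α) * s ^ 2 + 1) = y₄
  have e1 : s ^ 3 * (y₁ - y₃) - s ^ 2 * (γ / α) + s * (γ ^ 2 / (2 * α ^ 2)) -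
      (s ^ 3 * (y₂ - y₄) - s ^ 2 * ((1 - γ) / (1 - α)) +
        s * ((1 - γ) ^ 2 / (2 * (1 - α) ^ 2))) =
      s ^ 3 * (y₁ - y₂ - (y₃ - y₄)) - s ^ 2 * d₁ + s * d₂ := by
    rw [hd₁, hd₂]
    ring
  have e2 : 1 / (α * (1 - α)) + (α - γ) ^ 2 / (α ^ 2 * (1 - α) ^ 2) =
      1 / α + 1 / (1 - α) + d₁ ^ 2 := by
    rw [hd₁]
    field_simp
    ring
  have e3 : (2 * α * γ - γ - α ^ 2) / ((1 - α) ^ 2 * α ^ 2) +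
      (α - γ) ^ 2 * (α * (2 * γ - 1) - γ) / ((1 - α) ^ 3 * α ^ 3) =
      -(γ / α ^ 2) - (1 - γ) / (1 - α) ^ 2 - 2 * d₁ * d₂ := by
    rw [hd₁, hd₂]
    field_simp
    ring
  rw [e1, e2, e3]
  field_simp
  ring
end

section
/- Fix α ∈ (0,1) and γ ∈ (0,1), set x = x(n) = ⌊αn⌋, and let Z_n have density f_{n,x}. Consider the weight function φ₂(p) = κ₂(α,γ)^{−1}·p^{γ√n}·(1−p)^{(1−γ)√n} with κ₂(α,γ) = Γ(x+γ√n+1)·Γ(n−x+1+(1−γ)√n)·Γ(n+2) / ( Γ(x+1)·Γ(n−x+1)·Γ(n+2+√n) ), so that ∫₀¹ φ₂(p)·f_{n,x}(p) dp = 1, and the weighted variance V^{φ₂}_n = ∫₀¹ (p − e_n)²·φ₂(p)·f_{n,x}(p) dp with e_n = (x+1)/(n+2) the (unweighted) mean of Z_n. Then there exist a constant C > 0 and N such that for all n ≥ N, V^{φ₂}_n ≥ ( α(1−α) + (α−γ)² )/n + ( −2α + α² + γ + 2αγ − 2γ² )/n^{3/2} − C·n^{−2}. -/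
open MeasureTheory Real Filter

/-- The Beta(x+1, n-x+1) posterior density `f_{n,x}` on `[0,1]`, extended by `0` outside. -/
noncomputable def betaDensity (n x : ℕ) (p : ℝ) : ℝ :=
  if 0 ≤ p ∧ p ≤ 1 then ((n : ℝ) + 1) * (n.choose x : ℝ) * p ^ x * (1 - p) ^ (n - x) else 0

/-- The normalizing constant `κ₂(α,γ)` for the weight `p^{γ√n} (1-p)^{(1-γ)√n}`
(here `x = ⌊αn⌋`). -/
noncomputable def kappa2 (α γ : ℝ) (n : ℕ) : ℝ :=
  Real.Gamma ((Nat.floor (α * n) : ℝ) + γ * Real.sqrt n + 1) *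
    Real.Gamma ((n : ℝ) - (Nat.floor (α * n) : ℝ) + 1 + (1 - γ) * Real.sqrt n) *
    Real.Gamma ((n : ℝ) + 2) /
  (Real.Gamma ((Nat.floor (α * n) : ℝ) + 1) *
    Real.Gamma ((n : ℝ) - (Nat.floor (α * n) : ℝ) + 1) *
    Real.Gamma ((n : ℝ) + 2 + Real.sqrt n))

/-- The weight function `φ₂(p) = κ₂(α,γ)⁻¹ p^{γ√n} (1-p)^{(1-γ)√n}`. -/
noncomputable def phi2 (α γ : ℝ) (n : ℕ) (p : ℝ) : ℝ :=
  (kappa2 α γ n)⁻¹ * p ^ (γ * Real.sqrt n) * (1 - p) ^ ((1 - γ) * Real.sqrt n)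

/-- The weighted variance `V^{φ₂}_n = ∫₀¹ (p - e_n)² φ₂(p) f_{n,x}(p) dp`, with
`e_n = (x+1)/(n+2)` the unweighted mean. -/
noncomputable def weightedVar2 (α γ : ℝ) (n : ℕ) : ℝ :=
  ∫ p in Set.Ioo (0 : ℝ) 1,
    (p - ((Nat.floor (α * n) : ℝ) + 1) / ((n : ℝ) + 2)) ^ 2 * phi2 α γ n p *
      betaDensity n (Nat.floor (α * n)) p

/-- The beta kernel is integrable on the open unit interval. -/
lemma integrableOn_betaKernel {a b : ℝ} (ha : 0 < a) (hb : 0 < b) :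
    IntegrableOn (fun p : ℝ => p ^ (a - 1) * (1 - p) ^ (b - 1)) (Set.Ioo 0 1) := by
  have h := Complex.betaIntegral_convergent (u := a) (v := b) (by simpa) (by simpa)
  rw [intervalIntegrable_iff_integrableOn_Ioo_of_le zero_le_one] at h
  refine IntegrableOn.congr_fun h.re (fun p hp => ?_) measurableSet_Ioo
  have h1 : 0 ≤ 1 - p := by linarith [hp.2]
  simp only [RCLike.re_to_complex]
  norm_cast
  rw [← Complex.ofReal_cpow hp.1.le, ← Complex.ofReal_cpow h1]
  norm_cast

/-- The real beta integral. -/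
lemma integral_betaKernel {a b : ℝ} (ha : 0 < a) (hb : 0 < b) :
    ∫ p in Set.Ioo (0 : ℝ) 1, p ^ (a - 1) * (1 - p) ^ (b - 1) = ProbabilityTheory.beta a b := by
  have h := Complex.betaIntegral_convergent (u := a) (v := b) (by simpa) (by simpa)
  rw [intervalIntegrable_iff_integrableOn_Ioc_of_le zero_le_one] at h
  rw [ProbabilityTheory.beta_eq_betaIntegralReal a b ha hb, Complex.betaIntegral,
    intervalIntegral.integral_of_le zero_le_one, ← integral_Ioc_eq_integral_Ioo,
    ← RCLike.re_to_complex, ← integral_re h]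
  refine setIntegral_congr_fun measurableSet_Ioc fun p hp => ?_
  have h1 : 0 ≤ 1 - p := by linarith [hp.2]
  simp only [RCLike.re_to_complex]
  norm_cast
  rw [← Complex.ofReal_cpow hp.1.le, ← Complex.ofReal_cpow h1]
  norm_cast

/-- The functional equation of the beta function in its first argument. -/
lemma beta_add_one_left {a b : ℝ} (ha : 0 < a) (hb : 0 < b) :
    ProbabilityTheory.beta (a + 1) b = a / (a + b) * ProbabilityTheory.beta a b := by
  have hab : 0 < a + b := add_pos ha hb
  have hg := (Real.Gamma_pos_of_pos hab).ne'
  rw [ProbabilityTheory.beta, ProbabilityTheory.beta, Real.Gamma_add_one ha.ne',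
    show a + 1 + b = (a + b) + 1 by ring, Real.Gamma_add_one hab.ne']
  field_simp

/-- The second moment of a beta distribution around an arbitrary point. -/
lemma integral_sub_sq_mul_betaKernel {a b : ℝ} (ha : 0 < a) (hb : 0 < b) (e : ℝ) :
    ∫ p in Set.Ioo (0 : ℝ) 1, (p - e) ^ 2 * (p ^ (a - 1) * (1 - p) ^ (b - 1)) =
      (a * b / ((a + b) ^ 2 * (a + b + 1)) + (a / (a + b) - e) ^ 2) *
        ProbabilityTheory.beta a b := by
  have ha1 : 0 < a + 1 := by linarith
  have ha2 : 0 < a + 1 + 1 := by linarith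
  have i0 := integrableOn_betaKernel ha hb
  have i1 := integrableOn_betaKernel ha1 hb
  have i2 := integrableOn_betaKernel ha2 hb
  have i21 : IntegrableOn (fun p : ℝ => p ^ (a + 1 + 1 - 1) * (1 - p) ^ (b - 1)
      - 2 * e * (p ^ (a + 1 - 1) * (1 - p) ^ (b - 1))) (Set.Ioo 0 1) := i2.sub (i1.const_mul _)
  have expand : Set.EqOn (fun p : ℝ => (p - e) ^ 2 * (p ^ (a - 1) * (1 - p) ^ (b - 1)))
      (fun p : ℝ => p ^ (a + 1 + 1 - 1) * (1 - p) ^ (b - 1)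
        - 2 * e * (p ^ (a + 1 - 1) * (1 - p) ^ (b - 1))
        + e ^ 2 * (p ^ (a - 1) * (1 - p) ^ (b - 1))) (Set.Ioo 0 1) := by
    intro p hp
    have q1 : p ^ (a + 1 - 1) = p ^ (a - 1) * p := by
      rw [show a + 1 - 1 = (a - 1) + 1 by ring, rpow_add_one hp.1.ne']
    have q2 : p ^ (a + 1 + 1 - 1) = p ^ (a - 1) * p * p := by
      rw [show a + 1 + 1 - 1 = (a - 1) + 1 + 1 by ring, rpow_add_one hp.1.ne',
        rpow_add_one hp.1.ne']
    simp only [q1, q2]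
    ring
  rw [setIntegral_congr_fun measurableSet_Ioo expand,
    integral_add i21 (i0.const_mul _), integral_sub i2 (i1.const_mul _), integral_const_mul, integral_const_mul,
    integral_betaKernel ha hb, integral_betaKernel ha1 hb, integral_betaKernel ha2 hb,
    beta_add_one_left ha1 hb, beta_add_one_left ha hb]
  have hab : a + b ≠ 0 := by positivity
  have hab1 : a + 1 + b ≠ 0 := by positivity
  have hab2 : a + b + 1 ≠ 0 := by positivity
  field_simp
  ring

/-- Reweighting the posterior density yields the density of a beta distribution. -/
lemma phi2_mul_betaDensity {α γ : ℝ} {n : ℕ} (hα : α ∈ Set.Ioo (0 : ℝ) 1)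
    (hγ : γ ∈ Set.Ioo (0 : ℝ) 1) {a b p : ℝ}
    (ha : a = (⌊α * n⌋₊ : ℝ) + γ * √n + 1)
    (hb : b = (n : ℝ) - (⌊α * n⌋₊ : ℝ) + 1 + (1 - γ) * √n)
    (hp : p ∈ Set.Ioo (0 : ℝ) 1) :
    phi2 α γ n p * betaDensity n ⌊α * n⌋₊ p =
      (ProbabilityTheory.beta a b)⁻¹ * (p ^ (a - 1) * (1 - p) ^ (b - 1)) := by
  have hn : (0 : ℝ) ≤ n := n.cast_nonneg
  have hx : ⌊α * n⌋₊ ≤ n := Nat.floor_le_of_le (by nlinarith [hα.2])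
  set x := ⌊α * n⌋₊ with hx_def
  have hxn : (x : ℝ) ≤ n := by exact_mod_cast hx
  have hs : 0 ≤ √(n : ℝ) := sqrt_nonneg _
  have hγ0 := hγ.1
  have hγ1 : 0 < 1 - γ := by linarith [hγ.2]
  have ha0 : 0 < a := by rw [ha]; positivity
  have hb0 : 0 < b := by rw [hb]; have := mul_nonneg hγ1.le hs; linarith
  have h1p : 0 < 1 - p := by linarith [hp.2]
  have hab : a + b = (n : ℝ) + 2 + √n := by rw [ha, hb]; ring
  have hG1 : Real.Gamma ((n : ℝ) + 2) = (n + 1) * n.factorial := by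
    rw [show (n : ℝ) + 2 = (n + 1) + 1 by ring, Real.Gamma_add_one (by positivity),
      Real.Gamma_nat_eq_factorial]
  have hG2 : Real.Gamma ((n : ℝ) - x + 1) = (n - x).factorial := by
    rw [← Nat.cast_sub hx, Real.Gamma_nat_eq_factorial]
  have hk : kappa2 α γ n = ProbabilityTheory.beta a b * ((n + 1) * n.choose x) := by
    rw [kappa2, ← hx_def, ← ha, ← hb, ← hab, hG1, hG2, Real.Gamma_nat_eq_factorial,
      Nat.cast_choose ℝ hx, ProbabilityTheory.beta]
    have := (Real.Gamma_pos_of_pos (add_pos ha0 hb0)).ne'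
    field_simp
  have e1 : p ^ (a - 1) = p ^ (γ * √n) * p ^ x := by
    rw [← rpow_natCast, ← rpow_add hp.1, ha]
    congr 1
    ring
  have e2 : (1 - p) ^ (b - 1) = (1 - p) ^ ((1 - γ) * √n) * (1 - p) ^ (n - x) := by
    rw [← rpow_natCast, ← rpow_add h1p, hb, Nat.cast_sub hx]
    congr 1
    ring
  have hc : (n.choose x : ℝ) ≠ 0 := by exact_mod_cast (Nat.choose_pos hx).ne'
  have hbe := (ProbabilityTheory.beta_pos ha0 hb0).ne'
  have hn1 : (n : ℝ) + 1 ≠ 0 := by positivity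
  rw [phi2, betaDensity, if_pos ⟨hp.1.le, hp.2.le⟩, hk, e1, e2]
  field_simp

/-- Closed form of the weighted variance as a rational function. -/
lemma weightedVar2_eq {α γ : ℝ} {n : ℕ} (hα : α ∈ Set.Ioo (0 : ℝ) 1)
    (hγ : γ ∈ Set.Ioo (0 : ℝ) 1) {a b : ℝ}
    (ha : a = (⌊α * n⌋₊ : ℝ) + γ * √n + 1)
    (hb : b = (n : ℝ) - (⌊α * n⌋₊ : ℝ) + 1 + (1 - γ) * √n) :
    weightedVar2 α γ n = a * b / ((a + b) ^ 2 * (a + b + 1)) +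
      (a / (a + b) - ((⌊α * n⌋₊ : ℝ) + 1) / ((n : ℝ) + 2)) ^ 2 := by
  have hn : (0 : ℝ) ≤ n := n.cast_nonneg
  have hx : ⌊α * n⌋₊ ≤ n := Nat.floor_le_of_le (by nlinarith [hα.2])
  have hxn : (⌊α * n⌋₊ : ℝ) ≤ n := by exact_mod_cast hx
  have hs : 0 ≤ √(n : ℝ) := sqrt_nonneg _
  have hγ0 := hγ.1
  have hγ1 : 0 < 1 - γ := by linarith [hγ.2]
  have ha0 : 0 < a := by rw [ha]; positivity
  have hb0 : 0 < b := by rw [hb]; have := mul_nonneg hγ1.le hs; linarith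
  have hbe := (ProbabilityTheory.beta_pos ha0 hb0).ne'
  rw [weightedVar2, setIntegral_congr_fun (g := fun p => (ProbabilityTheory.beta a b)⁻¹ *
    ((p - ((⌊α * n⌋₊ : ℝ) + 1) / ((n : ℝ) + 2)) ^ 2 * (p ^ (a - 1) * (1 - p) ^ (b - 1))))
    measurableSet_Ioo ?_, integral_const_mul, integral_sub_sq_mul_betaKernel ha0 hb0]
  · field_simp
  · intro p hp
    simp only [mul_assoc _ (phi2 α γ n p), phi2_mul_betaDensity hα hγ ha hb hp]
    ring

/-- Asymptotic lower bound for the rational closed form, in terms of `s = √n`. -/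
lemma rational_lower_bound {α γ d s : ℝ} (hα : α ∈ Set.Ioo (0 : ℝ) 1)
    (hγ : γ ∈ Set.Ioo (0 : ℝ) 1) (hd : d ∈ Set.Icc (0 : ℝ) 1) (hs : 1 ≤ s) :
    (α * (1 - α) + (α - γ) ^ 2) / s ^ 2 +
        (-2 * α + α ^ 2 + γ + 2 * α * γ - 2 * γ ^ 2) / s ^ 3 - 2000 / s ^ 4 ≤
      (α * s ^ 2 + γ * s + d) * ((1 - α) * s ^ 2 + (1 - γ) * s + (2 - d)) /
          ((s ^ 2 + s + 2) ^ 2 * (s ^ 2 + s + 2 + 1)) +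
        ((α * s ^ 2 + γ * s + d) / (s ^ 2 + s + 2) - (α * s ^ 2 + d) / (s ^ 2 + 2)) ^ 2 := by
  obtain ⟨hα0, hα1⟩ := hα
  obtain ⟨hγ0, hγ1⟩ := hγ
  obtain ⟨hd0, hd1⟩ := hd
  have hs0 : 0 < s := by linarith
  set A := α * (1 - α) + (α - γ) ^ 2 with hA
  set B := -2 * α + α ^ 2 + γ + 2 * α * γ - 2 * γ ^ 2 with hB
  set e := (α * s ^ 2 + d) / (s ^ 2 + 2) with he
  have hmean : (α * s ^ 2 + γ * s + d) / (s ^ 2 + s + 2) - e =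
      s * (γ - e) / (s ^ 2 + s + 2) := by
    rw [he]
    field_simp
    ring
  have hdev : (γ - α) ^ 2 * s ^ 2 - 4 ≤ s ^ 2 * (γ - e) ^ 2 := by
    have he' : e = α + (d - 2 * α) / (s ^ 2 + 2) := by
      rw [he]
      field_simp
      ring
    have hδ : |(d - 2 * α) / (s ^ 2 + 2)| * s ^ 2 ≤ 2 := by
      rw [abs_div, abs_of_pos (show 0 < s ^ 2 + 2 by positivity), div_mul_eq_mul_div,
        div_le_iff₀ (by positivity)]
      have : |d - 2 * α| ≤ 2 := abs_le.2 ⟨by linarith, by linarith⟩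
      nlinarith [sq_nonneg s]
    have hg : |γ - α| ≤ 1 := abs_le.2 ⟨by linarith, by linarith⟩
    rw [he']
    generalize (d - 2 * α) / (s ^ 2 + 2) = δ at hδ
    have h1 : (γ - α) * δ * s ^ 2 ≤ 2 := by
      calc (γ - α) * δ * s ^ 2 ≤ |(γ - α) * δ| * s ^ 2 := by gcongr; exact le_abs_self _
        _ = |γ - α| * (|δ| * s ^ 2) := by rw [abs_mul]; ring
        _ ≤ 1 * 2 := by gcongr
        _ = 2 := by ring
    nlinarith [sq_nonneg (s * δ)]
  have hab : α * (1 - α) * s ^ 4 + (α + γ - 2 * α * γ) * s ^ 3 ≤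
      (α * s ^ 2 + γ * s + d) * ((1 - α) * s ^ 2 + (1 - γ) * s + (2 - d)) := by
    have h1 : 0 ≤ 1 - α := by linarith
    have h2 : 0 ≤ 1 - γ := by linarith
    have h3 : 0 ≤ 2 - d := by linarith
    have : 0 ≤ (α * (2 - d) + γ * (1 - γ) + d * (1 - α)) * s ^ 2 +
      (γ * (2 - d) + d * (1 - γ)) * s + d * (2 - d) := by positivity
    nlinarith
  rw [hmean, div_pow, mul_pow]
  generalize (α * s ^ 2 + γ * s + d) * ((1 - α) * s ^ 2 + (1 - γ) * s + (2 - d)) = W at hab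
  generalize s ^ 2 * (γ - e) ^ 2 = U at hdev
  have hL : A / s ^ 2 + B / s ^ 3 - 2000 / s ^ 4 = (A * s ^ 2 + B * s - 2000) / s ^ 4 := by
    field_simp
  have hR : W / ((s ^ 2 + s + 2) ^ 2 * (s ^ 2 + s + 2 + 1)) + U / (s ^ 2 + s + 2) ^ 2 =
      (W + U * (s ^ 2 + s + 2 + 1)) / ((s ^ 2 + s + 2) ^ 2 * (s ^ 2 + s + 2 + 1)) := by
    field_simp
  rw [hL, hR, div_le_div_iff₀ (by positivity) (by positivity)]
  have hAle : A ≤ 10 := by nlinarith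
  have hBle : B ≤ 10 := by nlinarith
  have hAB : α + γ - 2 * α * γ + (γ - α) ^ 2 = 3 * A + B := by rw [hA, hB]; ring
  have hpow : ∀ k ≤ 6, s ^ k ≤ s ^ 6 := fun k hk => pow_le_pow_right₀ hs hk
  have hA0 : ∀ k ≤ 6, A * s ^ k ≤ 10 * s ^ 6 := fun k hk =>
    mul_le_mul hAle (hpow k hk) (by positivity) (by norm_num)
  have hB0 : ∀ k ≤ 6, B * s ^ k ≤ 10 * s ^ 6 := fun k hk =>
    mul_le_mul hBle (hpow k hk) (by positivity) (by norm_num)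
  have lower : (A * s ^ 4 + (3 * A + B) * s ^ 3 - 20 * s ^ 2) * s ^ 4 ≤
      (W + U * (s ^ 2 + s + 2 + 1)) * s ^ 4 := by
    gcongr
    have hU := mul_le_mul_of_nonneg_right hdev (show 0 ≤ s ^ 2 + s + 2 + 1 by positivity)
    have hg := mul_nonneg (sq_nonneg (γ - α)) (sq_nonneg s)
    rw [← hAB, hA]
    nlinarith
  have upper : (A * s ^ 2 + B * s - 2000) * ((s ^ 2 + s + 2) ^ 2 * (s ^ 2 + s + 2 + 1)) ≤
      (A * s ^ 4 + (3 * A + B) * s ^ 3 - 20 * s ^ 2) * s ^ 4 := by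
    have expand : (A * s ^ 2 + B * s - 2000) * ((s ^ 2 + s + 2) ^ 2 * (s ^ 2 + s + 2 + 1)) =
        A * s ^ 8 + (3 * A + B) * s ^ 7
        + (10 * (A * s ^ 6) + 15 * (A * s ^ 5) + 23 * (A * s ^ 4) + 16 * (A * s ^ 3)
          + 12 * (A * s ^ 2))
        + (3 * (B * s ^ 6) + 10 * (B * s ^ 5) + 15 * (B * s ^ 4) + 23 * (B * s ^ 3)
          + 16 * (B * s ^ 2) + 12 * (B * s ^ 1))
        - 2000 * (s ^ 6 + 3 * s ^ 5 + 10 * s ^ 4 + 15 * s ^ 3 + 23 * s ^ 2 + 16 * s + 12) := by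
      ring
    have hpos : 0 ≤ 3 * s ^ 5 + 10 * s ^ 4 + 15 * s ^ 3 + 23 * s ^ 2 + 16 * s + 12 := by
      positivity
    have hs6 : 0 ≤ s ^ 6 := by positivity
    rw [expand]
    linarith [hA0 6 (by norm_num), hA0 5 (by norm_num), hA0 4 (by norm_num), hA0 3 (by norm_num),
      hA0 2 (by norm_num), hB0 6 (by norm_num), hB0 5 (by norm_num), hB0 4 (by norm_num),
      hB0 3 (by norm_num), hB0 2 (by norm_num), hB0 1 (by norm_num)]
  exact upper.trans lower

/-- For `α, γ ∈ (0,1)` and `x = ⌊αn⌋`, eventually in `n`,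
`V^{φ₂}_n ≥ (α(1-α) + (α-γ)²)/n + (-2α + α² + γ + 2αγ - 2γ²)/n^{3/2} - C n^{-2}`. -/
theorem weighted_variance_bound_phi2
    (α γ : ℝ) (hα : α ∈ Set.Ioo (0 : ℝ) 1) (hγ : γ ∈ Set.Ioo (0 : ℝ) 1) :
    ∃ C > (0 : ℝ), ∃ N : ℕ, ∀ n ≥ N,
      weightedVar2 α γ n ≥
        (α * (1 - α) + (α - γ) ^ 2) / n +
          (-2 * α + α ^ 2 + γ + 2 * α * γ - 2 * γ ^ 2) / (n : ℝ) ^ ((3 : ℝ) / 2) -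
          C * (n : ℝ) ^ (-(2 : ℝ)) := by
  refine ⟨2000, by norm_num, 1, fun n hn => ?_⟩
  have hn1 : (1 : ℝ) ≤ n := by exact_mod_cast hn
  have hn0 : (0 : ℝ) ≤ n := by linarith
  obtain ⟨s, hs⟩ : ∃ s, s = √(n : ℝ) := ⟨_, rfl⟩
  have hs1 : 1 ≤ s := by rw [hs]; exact one_le_sqrt.2 hn1
  have hsn : (n : ℝ) = s ^ 2 := by rw [hs, sq_sqrt hn0]
  obtain ⟨d, hd⟩ : ∃ d, d = (⌊α * n⌋₊ : ℝ) + 1 - α * n := ⟨_, rfl⟩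
  have hfl := Nat.floor_le (mul_nonneg hα.1.le hn0)
  have hlt := Nat.lt_floor_add_one (α * (n : ℝ))
  have hd01 : d ∈ Set.Icc (0 : ℝ) 1 := ⟨by linarith, by linarith⟩
  have hfloor : (⌊α * n⌋₊ : ℝ) = α * s ^ 2 + d - 1 := by rw [hd, hsn]; ring
  have h32 : (n : ℝ) ^ ((3 : ℝ) / 2) = s ^ 3 := by
    rw [hs, sqrt_eq_rpow, ← rpow_natCast, ← rpow_mul hn0]
    norm_num
  have h2 : (n : ℝ) ^ (-(2 : ℝ)) = 1 / s ^ 4 := by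
    rw [rpow_neg hn0, rpow_two, hsn]
    ring
  have h := rational_lower_bound hα hγ hd01 hs1
  rw [weightedVar2_eq hα hγ rfl rfl, ← hs, hfloor, h32, h2, hsn, ge_iff_le]
  convert! h using 1
  · ring
  · have e1 : α * s ^ 2 + d - 1 + γ * s + 1 = α * s ^ 2 + γ * s + d := by ring
    have e2 : s ^ 2 - (α * s ^ 2 + d - 1) + 1 + (1 - γ) * s =
      (1 - α) * s ^ 2 + (1 - γ) * s + (2 - d) := by ring
    have e3 : α * s ^ 2 + γ * s + d + ((1 - α) * s ^ 2 + (1 - γ) * s + (2 - d)) =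
      s ^ 2 + s + 2 := by ring
    have e4 : α * s ^ 2 + d - 1 + 1 = α * s ^ 2 + d := by ring
    rw [e1, e2, e3, e4]
end
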